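/- arXiv:math/0102044 — 4 statements merged into one kernel-verified Lean document; each statement's English description precedes it below -/
import Mathlib

section
/- Let λ be a regular uncountable cardinal and T a tree of height λ in which every element belongs to some branch. For α < λ let G_α be the free group generated by the level T_α, and for α < β < λ let π_{α,β} : G_β → G_α be the homomorphism sending each generator t ∈ T_β to its unique predecessor in T_α. Then the inverse limit of the system (G_α, π_{α,β} | α < β < λ) is isomorphic to the free group generated by the set of branches of T. -/
/-!
STATEMENT 5: Let λ be a regular uncountable cardinal and T a tree of height λ
in which every element belongs to some branch.  For α < λ let G_α be the free
group generated by the level T_α, and for α < β < λ let π_{α,β} : G_β → G_α be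
the homomorphism sending each generator t ∈ T_β to its unique predecessor in
T_α.  Then the inverse limit of the system (G_α, π_{α,β} | α < β < λ) is
isomorphic to the free group generated by the set of branches of T.

A tree is a partial order in which the set of strict predecessors of each
element is well-ordered (hypothesis `wo`); `lvl t` is the order type of the
set of strict predecessors of `t`; "T has height λ" is expressed by: every
level is `< λ.ord` and every level `< λ.ord` is nonempty.  A branch is a
downward-closed chain meeting every level `< λ.ord`.  The predecessor maps
are given as data `pr` uniquely characterized by the hypothesis `hpr`.
-/

universe u

open Cardinal

/-- The level of an element of a tree: the order type of its set of strict
predecessors. -/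
noncomputable def lvl {T : Type u} [PartialOrder T]
    (wo : ∀ t : T, IsWellOrder {s : T // s < t} (· < ·)) (t : T) : Ordinal.{u} :=
  @Ordinal.type {s : T // s < t} (· < ·) (wo t)

/-- `b` is a branch of a tree of height `lam.ord`: a downward-closed chain
meeting every level `< lam.ord`. -/
def IsBranch {T : Type u} [PartialOrder T]
    (wo : ∀ t : T, IsWellOrder {s : T // s < t} (· < ·))
    (lam : Cardinal.{u}) (b : Set T) : Prop :=
  IsChain (· ≤ ·) b ∧ (∀ s t : T, t ∈ b → s ≤ t → s ∈ b) ∧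
    ∀ α < lam.ord, ∃ t ∈ b, lvl wo t = α

/-- The inverse limit of the system of free groups on the levels of the tree,
with connecting maps induced by the predecessor maps `pr`. -/
def TreeInvLimit {T : Type u} [PartialOrder T]
    (wo : ∀ t : T, IsWellOrder {s : T // s < t} (· < ·))
    (lam : Cardinal.{u})
    (pr : ∀ ⦃α β : Ordinal.{u}⦄, α < β →
      {t : T // lvl wo t = β} → {t : T // lvl wo t = α}) :
    Subgroup (∀ α : Set.Iio lam.ord, FreeGroup {t : T // lvl wo t = α.1}) where
  carrier := {g | ∀ (α β : Set.Iio lam.ord) (h : α.1 < β.1),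
    FreeGroup.map (pr h) (g β) = g α}
  one_mem' := by intro α β h; simp
  mul_mem' := by
    intro g g' hg hg' α β h
    simp only [Pi.mul_apply, map_mul, hg α β h, hg' α β h]
  inv_mem' := by
    intro g hg α β h
    simp only [Pi.inv_apply, map_inv, hg α β h]

namespace FreeGroup

theorem IsReduced.map_of_injOn {α β : Type*} {f : α → β} {L : List (α × Bool)}
    (hL : IsReduced L)
    (hf : ∀ x ∈ L, ∀ y ∈ L, f x.1 = f y.1 → x.1 = y.1) :
    IsReduced (L.map fun x => (f x.1, x.2)) := by
  rw [IsReduced, List.isChain_map]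
  exact List.IsChain.imp_of_mem_imp (fun x y hx hy h hxy => h (hf x hx y hy hxy)) hL

theorem norm_map_le {α β : Type*} [DecidableEq α] [DecidableEq β] (f : α → β)
    (x : FreeGroup α) : norm (map f x) ≤ norm x := by
  rw [← mk_toWord (x := x), map.mk, mk_toWord]
  exact norm_mk_le.trans_eq (List.length_map _)

theorem toWord_map_of_norm_eq {α β : Type*} [DecidableEq α] [DecidableEq β] {f : α → β}
    {x : FreeGroup α} (h : norm (map f x) = norm x) :
    toWord (map f x) = x.toWord.map fun a => (f a.1, a.2) := by
  have hmk : map f x = mk (x.toWord.map fun a => (f a.1, a.2)) := by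
    rw [← map.mk, mk_toWord]
  have hred : Red (x.toWord.map fun a => (f a.1, a.2)) (toWord (map f x)) := by
    rw [hmk, toWord_mk]
    exact reduce.red
  refine hred.sublist.eq_of_length ?_
  rw [List.length_map]
  exact h

section InverseLimit

variable {I : Type*} [LinearOrder I] {X : I → Type*} {B : Type*}
  {f : ∀ ⦃i j : I⦄, i < j → X j → X i} {ev : ∀ i, B → X i}

theorem exists_forall_norm_le [Nonempty I] (hI : ∀ s : ℕ → I, ∃ i, ∀ n, s n ≤ i)
    [∀ i, DecidableEq (X i)] {g : ∀ i, FreeGroup (X i)}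
    (hg : ∀ i j (h : i < j), map (f h) (g j) = g i) :
    ∃ i, ∀ j, norm (g j) ≤ norm (g i) := by
  by_contra! hunb
  choose next hnext using hunb
  obtain ⟨i₀⟩ := ‹Nonempty I›
  have hs : StrictMono fun n : ℕ => norm (g (next^[n] i₀)) := by
    refine strictMono_nat_of_lt_succ fun n => ?_
    rw [Function.iterate_succ_apply']
    exact hnext _
  obtain ⟨i, hi⟩ := hI fun n => next^[n] i₀
  have hle : norm (g (next^[norm (g i) + 1] i₀)) ≤ norm (g i) := by
    rcases (hi (norm (g i) + 1)).lt_or_eq with h | h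
    · rw [← hg _ _ h]
      exact norm_map_le _ _
    · exact (congrArg (fun k => norm (g k)) h).le
  exact absurd ((hs.le_apply (x := norm (g i) + 1)).trans hle) (by simp)

theorem exists_injOn_eval [Nonempty I]
    (hev : ∀ i j (h : i < j) b, f h (ev j b) = ev i b)
    (hinj : ∀ b c, (∀ i, ev i b = ev i c) → b = c) (S : Finset B) :
    ∃ i, ∀ b ∈ S, ∀ c ∈ S, ev i b = ev i c → b = c := by
  classical
  have hsep : ∀ p : B × B, ∃ i, ev i p.1 = ev i p.2 → p.1 = p.2 := by
    intro p
    by_contra! h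
    obtain ⟨i⟩ := ‹Nonempty I›
    exact (h i).2 (hinj _ _ fun j => (h j).1)
  choose k hk using hsep
  obtain ⟨M, hM⟩ := ((S ×ˢ S).image k).exists_le
  refine ⟨M, fun b hb c hc h => hk (b, c) ?_⟩
  have hle : k (b, c) ≤ M :=
    hM _ (Finset.mem_image_of_mem k (Finset.mk_mem_product hb hc))
  rcases hle.lt_or_eq with hlt | heq
  · rw [← hev _ _ hlt b, ← hev _ _ hlt c, h]
  · rw [heq]
    exact h

theorem eq_one_of_forall_map_eval_eq_one [Nonempty I]
    (hev : ∀ i j (h : i < j) b, f h (ev j b) = ev i b)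
    (hinj : ∀ b c, (∀ i, ev i b = ev i c) → b = c)
    {w : FreeGroup B} (hw : ∀ i, map (ev i) w = 1) : w = 1 := by
  classical
  obtain ⟨i, hi⟩ := exists_injOn_eval hev hinj (w.toWord.map Prod.fst).toFinset
  have hred : IsReduced (w.toWord.map fun x => (ev i x.1, x.2)) := by
    refine isReduced_toWord.map_of_injOn fun x hx y hy => hi _ ?_ _ ?_ <;>
      rw [List.mem_toFinset]
    exacts [List.mem_map_of_mem hx, List.mem_map_of_mem hy]
  have h := hw i
  rw [← mk_toWord (x := w), map.mk, ← toWord_eq_nil_iff, toWord_mk, hred.reduce_eq,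
    List.map_eq_nil_iff] at h
  exact toWord_eq_nil_iff.mp h

theorem exists_map_eval_eq [Nonempty I] (hI : ∀ s : ℕ → I, ∃ i, ∀ n, s n ≤ i)
    (hev : ∀ i j (h : i < j) b, f h (ev j b) = ev i b)
    (hsurj : ∀ (i₀ : I) (x : ∀ i, i₀ ≤ i → X i),
      (∀ i j (hi : i₀ ≤ i) (h : i < j), f h (x j (hi.trans h.le)) = x i hi) →
      ∃ b, ∀ i hi, ev i b = x i hi)
    {g : ∀ i, FreeGroup (X i)} (hg : ∀ i j (h : i < j), map (f h) (g j) = g i) :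
    ∃ w : FreeGroup B, ∀ i, map (ev i) w = g i := by
  classical
  obtain ⟨i₀, hi₀⟩ := exists_forall_norm_le hI hg
  have hnorm : ∀ j, i₀ ≤ j → norm (g j) = norm (g i₀) := by
    intro j hj
    refine (hi₀ j).antisymm ?_
    rcases hj.lt_or_eq with h | h
    · rw [← hg _ _ h]
      exact norm_map_le _ _
    · subst h
      rfl
  have hword : ∀ i j, i₀ ≤ i → (h : i < j) →
      (g i).toWord = (g j).toWord.map fun a => (f h a.1, a.2) := by
    intro i j hi h
    rw [← hg i j h]
    refine toWord_map_of_norm_eq ?_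
    rw [hg i j h, hnorm i hi, hnorm j (hi.trans h.le)]
  have hlt : ∀ j, i₀ ≤ j → ∀ k : Fin (norm (g i₀)), k.1 < (g j).toWord.length :=
    fun j hj k => k.2.trans_eq (hnorm j hj).symm
  have hbranch : ∀ k : Fin (norm (g i₀)), ∃ b, ∀ j (hj : i₀ ≤ j),
      ev j b = ((g j).toWord[k.1]'(hlt j hj k)).1 := by
    refine fun k => hsurj i₀ (fun j hj => ((g j).toWord[k.1]'(hlt j hj k)).1) ?_
    intro i j hi h
    simp only [hword i j hi h, List.getElem_map]
  choose b hb using hbranch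
  have hsign : ∀ j (hj : i₀ ≤ j) (k : Fin (norm (g i₀))),
      ((g j).toWord[k.1]'(hlt j hj k)).2 = ((g i₀).toWord[k.1]'(hlt i₀ le_rfl k)).2 := by
    intro j hj k
    rcases hj.lt_or_eq with h | h
    · simp only [hword i₀ j le_rfl h, List.getElem_map]
    · subst h
      rfl
  let w : FreeGroup B :=
    mk (List.ofFn fun k => (b k, ((g i₀).toWord[k.1]'(hlt i₀ le_rfl k)).2))
  have hw : ∀ j, i₀ ≤ j → map (ev j) w = g j := by
    intro j hj
    rw [← mk_toWord (x := g j), map.mk]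
    congr 1
    refine List.ext_getElem (by
      rw [List.length_map, List.length_ofFn]
      exact (hnorm j hj).symm) fun k h₁ h₂ => ?_
    have hk : k < norm (g i₀) := by simpa using h₁
    simp only [List.getElem_map, List.getElem_ofFn]
    exact Prod.ext (hb ⟨k, hk⟩ j hj) (hsign j hj ⟨k, hk⟩).symm
  refine ⟨w, fun i => ?_⟩
  rcases le_or_gt i₀ i with h | h
  · exact hw i h
  · have hcomp : f h ∘ ev i₀ = ev i := funext (hev i i₀ h)
    rw [← hg i i₀ h, ← hw i₀ le_rfl, map.comp, hcomp]

end InverseLimit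

end FreeGroup

section Tree

variable {T : Type u} [PartialOrder T] {wo : ∀ t : T, IsWellOrder {s : T // s < t} (· < ·)}
  {lam : Cardinal.{u}}

theorem lvl_strictMono (wo : ∀ t : T, IsWellOrder {s : T // s < t} (· < ·)) :
    StrictMono (lvl wo) := by
  intro s t hst
  have := wo s
  have := wo t
  refine Ordinal.type_lt_iff.mpr ⟨⟨⟨⟨fun x => ⟨x.1, x.2.trans hst⟩, ?_⟩, ?_⟩, ⟨s, hst⟩, ?_⟩⟩
  · intro x y h
    exact Subtype.ext (congrArg (fun z => z.1) h)
  · intro x y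
    exact Iff.rfl
  · intro x
    constructor
    · rintro ⟨y, rfl⟩
      exact y.2
    · intro h
      exact ⟨⟨x.1, h⟩, rfl⟩

theorem le_or_le_of_le_of_le (wo : ∀ t : T, IsWellOrder {s : T // s < t} (· < ·))
    {r s t : T} (hr : r ≤ t) (hs : s ≤ t) : r ≤ s ∨ s ≤ r := by
  rcases hr.lt_or_eq with hr | rfl
  · rcases hs.lt_or_eq with hs | rfl
    · have := wo t
      rcases trichotomous_of (α := {x : T // x < t}) (· < ·) ⟨r, hr⟩ ⟨s, hs⟩ with h | h | h
      · exact Or.inl (le_of_lt h)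
      · exact Or.inl (congrArg Subtype.val h).le
      · exact Or.inr (le_of_lt h)
    · exact Or.inl hr.le
  · exact Or.inr hs

theorem IsBranch.eq_of_lvl_eq {b : Set T} (hb : IsBranch wo lam b) {s t : T}
    (hs : s ∈ b) (ht : t ∈ b) (h : lvl wo s = lvl wo t) : s = t := by
  rcases hb.1.total hs ht with hle | hle
  · exact hle.eq_of_not_lt fun hlt => (lvl_strictMono wo hlt).ne h
  · exact (hle.eq_of_not_lt fun hlt => (lvl_strictMono wo hlt).ne h.symm).symm

/-- The element of a branch at a given level. -/
noncomputable def branchEval (wo : ∀ t : T, IsWellOrder {s : T // s < t} (· < ·))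
    (lam : Cardinal.{u}) (α : Set.Iio lam.ord) (b : {b : Set T // IsBranch wo lam b}) :
    {t : T // lvl wo t = α.1} :=
  ⟨(b.2.2.2 α.1 α.2).choose, (b.2.2.2 α.1 α.2).choose_spec.2⟩

theorem branchEval_mem (α : Set.Iio lam.ord) (b : {b : Set T // IsBranch wo lam b}) :
    (branchEval wo lam α b : T) ∈ b.1 :=
  (b.2.2.2 α.1 α.2).choose_spec.1

theorem branchEval_eq (α : Set.Iio lam.ord) (b : {b : Set T // IsBranch wo lam b})
    (t : {t : T // lvl wo t = α.1}) (ht : t.1 ∈ b.1) : branchEval wo lam α b = t :=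
  Subtype.ext (b.2.eq_of_lvl_eq (branchEval_mem α b) ht
    ((branchEval wo lam α b).2.trans t.2.symm))

theorem branch_eq_of_branchEval_eq (hlt : ∀ t : T, lvl wo t < lam.ord)
    {b c : {b : Set T // IsBranch wo lam b}}
    (h : ∀ α, branchEval wo lam α b = branchEval wo lam α c) : b = c := by
  have key : ∀ {b c : {b : Set T // IsBranch wo lam b}},
      (∀ α, branchEval wo lam α b = branchEval wo lam α c) → b.1 ⊆ c.1 := by
    intro b c h t ht
    have hbt := branchEval_eq ⟨lvl wo t, hlt t⟩ b ⟨t, rfl⟩ ht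
    have hmem := branchEval_mem ⟨lvl wo t, hlt t⟩ c
    rwa [← h, hbt] at hmem
  exact Subtype.ext ((key h).antisymm (key fun α => (h α).symm))

theorem exists_branchEval_eq
    {pr : ∀ ⦃α β : Ordinal.{u}⦄, α < β →
      {t : T // lvl wo t = β} → {t : T // lvl wo t = α}}
    (hpr : ∀ (α β : Ordinal.{u}) (h : α < β) (t : {t : T // lvl wo t = β}),
      ((pr h t : T) < (t : T)))
    (α₀ : Set.Iio lam.ord)
    (x : ∀ α : Set.Iio lam.ord, α₀ ≤ α → {t : T // lvl wo t = α.1})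
    (hx : ∀ (α β : Set.Iio lam.ord) (hα : α₀ ≤ α) (h : α < β),
      pr h (x β (hα.trans h.le)) = x α hα) :
    ∃ b, ∀ α hα, branchEval wo lam α b = x α hα := by
  have hmono : ∀ (α β : Set.Iio lam.ord) (hα : α₀ ≤ α) (h : α ≤ β),
      (x α hα : T) ≤ x β (hα.trans h) := by
    intro α β hα h
    rcases h.lt_or_eq with h | h
    · rw [← hx α β hα h]
      exact (hpr _ _ _ _).le
    · subst h
      exact le_rfl
  let b : Set T := {t | ∃ α hα, t ≤ (x α hα : T)}
  have hb : IsBranch wo lam b := by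
    refine ⟨?_, ?_, ?_⟩
    · rintro s ⟨α, hα, hs⟩ t ⟨β, hβ, ht⟩ -
      rcases le_total α β with h | h
      · exact le_or_le_of_le_of_le wo (hs.trans (hmono α β hα h)) ht
      · exact le_or_le_of_le_of_le wo hs (ht.trans (hmono β α hβ h))
    · rintro s t ⟨α, hα, ht⟩ hst
      exact ⟨α, hα, hst.trans ht⟩
    · intro α hα
      rcases le_or_gt α₀.1 α with h | h
      · exact ⟨x ⟨α, hα⟩ h, ⟨_, _, le_rfl⟩, (x ⟨α, hα⟩ h).2⟩
      · exact ⟨pr h (x α₀ le_rfl), ⟨α₀, le_rfl, (hpr _ _ _ _).le⟩, (pr h (x α₀ le_rfl)).2⟩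
  exact ⟨⟨b, hb⟩, fun α hα => branchEval_eq α _ _ ⟨α, hα, le_rfl⟩⟩

end Tree

theorem Cardinal.IsRegular.exists_forall_le_of_aleph0_lt {lam : Cardinal.{u}}
    (hreg : lam.IsRegular) (hunc : Cardinal.aleph0 < lam) (s : ℕ → Set.Iio lam.ord) :
    ∃ α, ∀ n, s n ≤ α := by
  have h : ⨆ n, (s n).1 < lam.ord := by
    refine Ordinal.lift_iSup_lt_of_lt_cof ?_ fun n => (s n).2
    simpa [hreg.cof_ord] using hunc
  exact ⟨⟨_, h⟩, fun n => Ordinal.le_iSup (fun n => (s n).1) n⟩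

theorem stmt5 (lam : Cardinal.{u}) (hreg : lam.IsRegular)
    (hunc : Cardinal.aleph0 < lam)
    (T : Type u) [PartialOrder T]
    (wo : ∀ t : T, IsWellOrder {s : T // s < t} (· < ·))
    (hlt : ∀ t : T, lvl wo t < lam.ord)
    (hne : ∀ α < lam.ord, ∃ t : T, lvl wo t = α)
    (hbr : ∀ t : T, ∃ b : Set T, IsBranch wo lam b ∧ t ∈ b)
    (pr : ∀ ⦃α β : Ordinal.{u}⦄, α < β →
      {t : T // lvl wo t = β} → {t : T // lvl wo t = α})
    (hpr : ∀ (α β : Ordinal.{u}) (h : α < β) (t : {t : T // lvl wo t = β}),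
      ((pr h t : T) < (t : T))) :
    Nonempty ((TreeInvLimit wo lam pr) ≃* FreeGroup {b : Set T // IsBranch wo lam b}) := by
  have hI := hreg.exists_forall_le_of_aleph0_lt hunc
  have : Nonempty (Set.Iio lam.ord) := ⟨⟨0, hreg.ord_pos⟩⟩
  have hev : ∀ (α β : Set.Iio lam.ord) (h : α < β) b,
      pr h (branchEval wo lam β b) = branchEval wo lam α b := fun α β h b =>
    (branchEval_eq α b _ (b.2.2.1 _ _ (branchEval_mem β b) (hpr _ _ _ _).le)).symm
  let Φ : FreeGroup {b : Set T // IsBranch wo lam b} →* TreeInvLimit wo lam pr :=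
    (MonoidHom.pi fun α => FreeGroup.map (branchEval wo lam α)).codRestrict _ (by
      intro w α β h
      have hcomp : pr h ∘ branchEval wo lam β = branchEval wo lam α := funext (hev α β h)
      change FreeGroup.map (pr h) (FreeGroup.map (branchEval wo lam β) w) =
        FreeGroup.map (branchEval wo lam α) w
      rw [FreeGroup.map.comp, hcomp])
  refine ⟨(MulEquiv.ofBijective Φ ⟨?_, ?_⟩).symm⟩
  · refine (injective_iff_map_eq_one Φ).mpr fun w hw => ?_
    exact FreeGroup.eq_one_of_forall_map_eval_eq_one hev
      (fun b c => branch_eq_of_branchEval_eq hlt)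
      fun α => congrFun (congrArg Subtype.val hw) α
  · rintro ⟨g, hg⟩
    obtain ⟨w, hw⟩ := FreeGroup.exists_map_eval_eq
      (f := fun (α β : Set.Iio lam.ord) (h : α < β) => pr h) hI hev
      (exists_branchEval_eq hpr) hg
    exact ⟨w, Subtype.ext (funext hw)⟩
end

section
/- Let λ be a regular uncountable cardinal and T a tree of height λ in which every element belongs to some branch, and suppose T has exactly μ branches with μ ≥ 1. For α < λ let G_α be the free group generated by the level T_α, and for α < β < λ let π_{α,β} : G_β → G_α be the homomorphism sending each generator t ∈ T_β to its unique predecessor in T_α. Then the inverse limit of the system (G_α, π_{α,β} | α < β < λ) has cardinality ℵ₀ · μ. -/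
/-!
STATEMENT 6: Let λ be a regular uncountable cardinal and T a tree of height λ
in which every element belongs to some branch, and suppose T has exactly μ
branches with μ ≥ 1.  For α < λ let G_α be the free group generated by the
level T_α, and for α < β < λ let π_{α,β} : G_β → G_α be the homomorphism
sending each generator t ∈ T_β to its unique predecessor in T_α.  Then the
inverse limit of the system (G_α, π_{α,β} | α < β < λ) has cardinality ℵ₀ · μ.

Definitions are as in Statement 5: `lvl t` is the order type of the set of
strict predecessors of `t`; "T has height λ" is expressed by: every level is
`< λ.ord` and every level `< λ.ord` is nonempty; a branch is a
downward-closed chain meeting every level `< λ.ord`; the predecessor maps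
are given as data `pr` uniquely characterized by the hypothesis `hpr`.
-/

universe u

open Cardinal

section FreeGroupMap

variable {X Y : Type*} (f : X → Y) (x : FreeGroup X)

theorem FreeGroup.norm_map_le_s6 [DecidableEq X] [DecidableEq Y] :
    (FreeGroup.map f x).norm ≤ x.norm := by
  conv_lhs => rw [← FreeGroup.mk_toWord (x := x), FreeGroup.map.mk]
  refine FreeGroup.norm_mk_le.trans ?_
  simp [FreeGroup.norm]

/-- If a map of generators does not shorten a reduced word, no cancellation takes place. -/
theorem FreeGroup.toWord_map_of_norm_eq_s6 [DecidableEq X] [DecidableEq Y]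
    (h : (FreeGroup.map f x).norm = x.norm) :
    (FreeGroup.map f x).toWord = x.toWord.map fun p => (f p.1, p.2) := by
  have e : (FreeGroup.map f x).toWord =
      FreeGroup.reduce (x.toWord.map fun p => (f p.1, p.2)) := by
    conv_lhs => rw [← FreeGroup.mk_toWord (x := x), FreeGroup.map.mk, FreeGroup.toWord_mk]
  rw [e]
  refine FreeGroup.reduce.red.sublist.eq_of_length ?_
  rw [← e, List.length_map]
  exact h

end FreeGroupMap

section Tree

variable {T : Type u} [PartialOrder T]
  {wo : ∀ t : T, IsWellOrder {s : T // s < t} (· < ·)} {lam : Cardinal.{u}}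

theorem lvl_lt_lvl {s t : T} (h : s < t) : lvl wo s < lvl wo t := by
  have := wo s
  have := wo t
  refine PrincipalSeg.ordinal_type_lt
    ⟨⟨⟨fun x => ⟨x.1, x.2.trans h⟩, fun x y hxy => Subtype.ext (congrArg (·.1) hxy)⟩, Iff.rfl⟩,
      ⟨s, h⟩, fun x => ⟨?_, fun hx => ⟨⟨x.1, hx⟩, rfl⟩⟩⟩
  rintro ⟨y, rfl⟩
  exact y.2

/-- The element of a branch at a given level. -/
noncomputable def branchAt (b : {b : Set T // IsBranch wo lam b}) (α : Set.Iio lam.ord) :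
    {t : T // lvl wo t = α.1} :=
  ⟨(b.2.2.2 α.1 α.2).choose, (b.2.2.2 α.1 α.2).choose_spec.2⟩

theorem branchAt_mem (b : {b : Set T // IsBranch wo lam b}) (α : Set.Iio lam.ord) :
    (branchAt b α : T) ∈ b.1 :=
  (b.2.2.2 α.1 α.2).choose_spec.1

theorem branchAt_eq {b : {b : Set T // IsBranch wo lam b}} {α : Set.Iio lam.ord}
    {t : {t : T // lvl wo t = α.1}} (ht : (t : T) ∈ b.1) : branchAt b α = t :=
  Subtype.ext (b.2.eq_of_lvl_eq (branchAt_mem b α) ht ((branchAt b α).2.trans t.2.symm))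

theorem branchAt_injective (hlt : ∀ t : T, lvl wo t < lam.ord) :
    Function.Injective
      (branchAt : {b : Set T // IsBranch wo lam b} →
        ∀ α : Set.Iio lam.ord, {t : T // lvl wo t = α.1}) := by
  intro b c h
  have key : ∀ {b c : {b : Set T // IsBranch wo lam b}}, branchAt b = branchAt c →
      b.1 ⊆ c.1 := by
    intro b c h t ht
    have hb : branchAt b ⟨lvl wo t, hlt t⟩ = ⟨t, rfl⟩ := branchAt_eq ht
    have hc := branchAt_mem c ⟨lvl wo t, hlt t⟩
    rwa [← h, hb] at hc
  exact Subtype.ext ((key h).antisymm (key h.symm))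

variable {pr : ∀ ⦃α β : Ordinal.{u}⦄, α < β →
  {t : T // lvl wo t = β} → {t : T // lvl wo t = α}}

theorem pr_branchAt
    (hpr : ∀ (α β : Ordinal.{u}) (h : α < β) (t : {t : T // lvl wo t = β}),
      ((pr h t : T) < (t : T)))
    (b : {b : Set T // IsBranch wo lam b}) {α β : Set.Iio lam.ord} (h : α.1 < β.1) :
    pr h (branchAt b β) = branchAt b α :=
  (branchAt_eq (b.2.2.1 _ _ (branchAt_mem b β) (hpr _ _ h _).le)).symm

/-- A thread of elements defined on a final segment of the levels lies on a branch. -/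
theorem exists_branch_of_thread
    (hbr : ∀ t : T, ∃ b : Set T, IsBranch wo lam b ∧ t ∈ b)
    (hpr : ∀ (α β : Ordinal.{u}) (h : α < β) (t : {t : T // lvl wo t = β}),
      ((pr h t : T) < (t : T)))
    (α₀ : Set.Iio lam.ord) (t : ∀ α : Set.Iio lam.ord, α₀ ≤ α → {t : T // lvl wo t = α.1})
    (ht : ∀ (α β : Set.Iio lam.ord) (hα : α₀ ≤ α) (hβ : α₀ ≤ β) (h : α.1 < β.1),
      pr h (t β hβ) = t α hα) :
    ∃ b : {b : Set T // IsBranch wo lam b}, ∀ α hα, branchAt b α = t α hα := by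
  have mono : ∀ (α β : Set.Iio lam.ord) (hα : α₀ ≤ α) (hβ : α₀ ≤ β), α ≤ β →
      (t α hα : T) ≤ t β hβ := by
    intro α β hα hβ h
    rcases h.eq_or_lt with rfl | h
    · exact le_rfl
    · rw [← ht α β hα hβ h]
      exact (hpr _ _ _ _).le
  refine ⟨⟨{s | ∃ α hα, s ≤ (t α hα : T)}, ?_, ?_, ?_⟩,
    fun α hα => branchAt_eq ⟨α, hα, le_rfl⟩⟩
  · rintro x ⟨α, hα, hx⟩ y ⟨β, hβ, hy⟩ hxy
    have hγ : α₀ ≤ max α β := hα.trans (le_max_left _ _)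
    obtain ⟨c, hc, hmem⟩ := hbr (t _ hγ)
    exact hc.1
      (hc.2.1 _ _ hmem (hx.trans (mono _ _ hα hγ (le_max_left _ _))))
      (hc.2.1 _ _ hmem (hy.trans (mono _ _ hβ hγ (le_max_right _ _)))) hxy
  · rintro x y ⟨α, hα, hy⟩ hxy
    exact ⟨α, hα, hxy.trans hy⟩
  · intro α hα
    rcases lt_or_ge α α₀.1 with h | h
    · exact ⟨pr h (t α₀ le_rfl), ⟨α₀, le_rfl, (hpr _ _ h _).le⟩, (pr h (t α₀ le_rfl)).2⟩
    · exact ⟨t ⟨α, hα⟩ h, ⟨⟨α, hα⟩, h, le_rfl⟩, (t ⟨α, hα⟩ h).2⟩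

/-- The canonical map from the free group on the branches to the inverse limit. -/
noncomputable def branchHom
    (hpr : ∀ (α β : Ordinal.{u}) (h : α < β) (t : {t : T // lvl wo t = β}),
      ((pr h t : T) < (t : T)))
    (x : FreeGroup {b : Set T // IsBranch wo lam b}) : TreeInvLimit wo lam pr :=
  ⟨fun α => FreeGroup.map (fun b => branchAt b α) x, fun α β h => by
    rw [FreeGroup.map.comp]
    congr 2
    exact funext fun b => pr_branchAt hpr b h⟩

end Tree

/-- A monotone sequence of natural numbers indexed by an ordinal of uncountable cofinality is
eventually constant. -/
theorem exists_forall_ge_eq_of_aleph0_lt_cof {o : Ordinal.{u}} (ho : ℵ₀ < o.cof)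
    {f : Set.Iio o → ℕ} (hf : Monotone f) : ∃ α₀, ∀ α, α₀ ≤ α → f α = f α₀ := by
  have hbdd : ∃ n, ∀ α, f α ≤ n := by
    by_contra! h
    choose a ha using h
    have hs : ⨆ n, (a n).1 < o :=
      Ordinal.lift_iSup_lt_of_lt_cof (by simpa using ho) fun n => (a n).2
    have h1 := ha (f ⟨_, hs⟩)
    have h2 : a (f ⟨_, hs⟩) ≤ (⟨_, hs⟩ : Set.Iio o) :=
      le_ciSup (f := fun n => (a n).1) (Ordinal.bddAbove_of_small) _
    exact absurd (hf h2) h1.not_ge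
  have hpos : (0 : Ordinal.{u}) < o := by
    rw [pos_iff_ne_zero]
    rintro rfl
    simp at ho
  have hfin : (Set.range f).Finite :=
    (Set.finite_Iic hbdd.choose).subset (by rintro _ ⟨α, rfl⟩; exact hbdd.choose_spec α)
  obtain ⟨_, ⟨α₀, rfl⟩, hmax⟩ :=
    hfin.exists_maximal ⟨_, ⟨⟨0, hpos⟩, rfl⟩⟩
  exact ⟨α₀, fun α h => (hmax ⟨α, rfl⟩ (hf h)).antisymm (hf h)⟩

section Tree

variable {T : Type u} [PartialOrder T]
  {wo : ∀ t : T, IsWellOrder {s : T // s < t} (· < ·)} {lam : Cardinal.{u}}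
  {pr : ∀ ⦃α β : Ordinal.{u}⦄, α < β →
    {t : T // lvl wo t = β} → {t : T // lvl wo t = α}}

theorem branchHom_surjective (hcof : ℵ₀ < lam.ord.cof)
    (hbr : ∀ t : T, ∃ b : Set T, IsBranch wo lam b ∧ t ∈ b)
    (hpr : ∀ (α β : Ordinal.{u}) (h : α < β) (t : {t : T // lvl wo t = β}),
      ((pr h t : T) < (t : T))) :
    Function.Surjective (branchHom (lam := lam) hpr) := by
  classical
  rintro ⟨g, hg⟩
  obtain ⟨α₀, hα₀⟩ := exists_forall_ge_eq_of_aleph0_lt_cof hcof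
    (f := fun α => (g α).norm) fun α β h => by
      rcases h.eq_or_lt with rfl | h
      · exact le_rfl
      · change (g α).norm ≤ (g β).norm
        rw [← hg α β h]
        exact FreeGroup.norm_map_le_s6 _ _
  have hlen : ∀ α, α₀ ≤ α → (g α).toWord.length = (g α₀).toWord.length := hα₀
  have hword : ∀ (α β : Set.Iio lam.ord) (_ : α₀ ≤ α) (_ : α₀ ≤ β) (h : α.1 < β.1),
      (g α).toWord = (g β).toWord.map fun p => (pr h p.1, p.2) := by
    intro α β hα hβ h
    rw [← FreeGroup.toWord_map_of_norm_eq_s6, hg α β h]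
    rw [hg α β h]
    exact (hα₀ α hα).trans (hα₀ β hβ).symm
  have hbranch : ∀ i : Fin (g α₀).toWord.length,
      ∃ b : {b : Set T // IsBranch wo lam b}, ∀ α hα,
        branchAt b α = ((g α).toWord[i.1]'((hlen α hα).symm ▸ i.2)).1 := by
    intro i
    refine exists_branch_of_thread (pr := pr) hbr hpr α₀
      (fun α hα => ((g α).toWord[i.1]'((hlen α hα).symm ▸ i.2)).1) ?_
    intro α β hα hβ h
    simp [hword α β hα hβ h]
  choose b hb using hbranch
  refine ⟨FreeGroup.mk (List.ofFn fun i => (b i, (g α₀).toWord[i].2)),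
    Subtype.ext (funext fun α => ?_)⟩
  have hge : ∀ α, α₀ ≤ α → FreeGroup.map (fun b => branchAt b α)
      (FreeGroup.mk (List.ofFn fun i => (b i, (g α₀).toWord[i].2))) = g α := by
    intro α hα
    rw [FreeGroup.map.mk]
    conv_rhs => rw [← FreeGroup.mk_toWord (x := g α)]
    congr 1
    refine List.ext_getElem (by simp [hlen α hα]) fun i h₁ h₂ => ?_
    have hi : i < (g α₀).toWord.length := hlen α hα ▸ h₂
    simp only [List.getElem_map, List.getElem_ofFn]
    refine Prod.ext (hb ⟨i, hi⟩ α hα) ?_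
    rcases hα.eq_or_lt with rfl | h
    · rfl
    · simp [hword α₀ α le_rfl hα h]
  rcases le_or_gt α₀ α with h | h
  · exact hge α h
  · refine ((branchHom hpr _).2 α α₀ h).symm.trans (Eq.trans ?_ (hg α α₀ h))
    exact congrArg _ (hge α₀ le_rfl)

theorem branchHom_of_injective (hlt : ∀ t : T, lvl wo t < lam.ord)
    (hpr : ∀ (α β : Ordinal.{u}) (h : α < β) (t : {t : T // lvl wo t = β}),
      ((pr h t : T) < (t : T))) :
    Function.Injective fun b => branchHom (lam := lam) hpr (FreeGroup.of b) := by
  intro b c h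
  refine branchAt_injective hlt (funext fun α => FreeGroup.of_injective ?_)
  simpa [branchHom] using congrFun (congrArg Subtype.val h) α

theorem branchHom_of_pow_injective (hpos : 0 < lam.ord)
    (hpr : ∀ (α β : Ordinal.{u}) (h : α < β) (t : {t : T // lvl wo t = β}),
      ((pr h t : T) < (t : T)))
    (b : {b : Set T // IsBranch wo lam b}) :
    Function.Injective fun n : ℕ => branchHom hpr (FreeGroup.of b ^ n) := by
  classical
  intro m n h
  have := congrArg FreeGroup.norm (congrFun (congrArg Subtype.val h) ⟨0, hpos⟩)
  simpa [branchHom, FreeGroup.norm_of_pow] using this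

end Tree

theorem stmt6 (lam : Cardinal.{u}) (hreg : lam.IsRegular)
    (hunc : Cardinal.aleph0 < lam)
    (T : Type u) [PartialOrder T]
    (wo : ∀ t : T, IsWellOrder {s : T // s < t} (· < ·))
    (hlt : ∀ t : T, lvl wo t < lam.ord)
    (hne : ∀ α < lam.ord, ∃ t : T, lvl wo t = α)
    (hbr : ∀ t : T, ∃ b : Set T, IsBranch wo lam b ∧ t ∈ b)
    (μ : Cardinal.{u}) (hμ : 1 ≤ μ)
    (hcount : Cardinal.mk {b : Set T // IsBranch wo lam b} = μ)
    (pr : ∀ ⦃α β : Ordinal.{u}⦄, α < β →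
      {t : T // lvl wo t = β} → {t : T // lvl wo t = α})
    (hpr : ∀ (α β : Ordinal.{u}) (h : α < β) (t : {t : T // lvl wo t = β}),
      ((pr h t : T) < (t : T))) :
    Cardinal.mk (TreeInvLimit wo lam pr) = Cardinal.lift.{u + 1} (Cardinal.aleph0 * μ) := by
  have hcof : ℵ₀ < lam.ord.cof := hunc.trans_le hreg.2
  have hpos : 0 < lam.ord := by
    rw [pos_iff_ne_zero]
    intro h
    simp [h] at hcof
  have : Nonempty {b : Set T // IsBranch wo lam b} := by
    rw [← Cardinal.mk_ne_zero_iff, hcount]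
    exact (zero_lt_one.trans_le hμ).ne'
  rw [Cardinal.mul_eq_max_of_aleph0_le_left le_rfl (zero_lt_one.trans_le hμ).ne', max_comm,
    ← hcount]
  rw [← Cardinal.lift_id'.{u, u + 1} #(TreeInvLimit wo lam pr)]
  apply le_antisymm
  · rw [← Cardinal.mk_freeGroup]
    exact Cardinal.lift_mk_le_lift_mk_of_surjective (branchHom_surjective hcof hbr hpr)
  · rw [Cardinal.lift_max]
    refine max_le ?_ ?_
    · exact Cardinal.lift_mk_le_lift_mk_of_injective (branchHom_of_injective hlt hpr)
    · simpa using Cardinal.lift_mk_le_lift_mk_of_injective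
        (branchHom_of_pow_injective hpos hpr (Classical.arbitrary _))
end

section
/- The poset Q defined below is ω₁-closed: every strictly increasing sequence (p_n)_{n<ω} in Q has an upper bound in Q. -/
/-!
STATEMENT 7: The poset Q defined below is ω₁-closed: every strictly
increasing sequence (p_n)_{n<ω} in Q has an upper bound in Q.

A condition is p = (α, T, u, (η_i | i ∈ u)) where α < ω₁, T is a countable
downward-closed subtree of ω^{≤α}, u is a countable nonempty subset of ℵ_ω,
and each η_i (i ∈ u) is a branch of T, i.e. a sequence of length α all of
whose initial segments (including itself) lie in T.

A sequence of length β ≤ α is encoded as a pair (β, f) with f : Ordinal → ℕ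
normalized so that f i = 0 for i ≥ β; initial segments are obtained by
truncation.  The branch family η is encoded as a total function
Ordinal → (Ordinal → ℕ) normalized to the zero sequence outside u and beyond α.
-/

/-- A condition of the poset `Q`. -/
structure QCond : Type 1 where
  /-- the stage `α < ω₁` -/
  a : Ordinal.{0}
  ha : a < (Cardinal.aleph 1).ord
  /-- the tree, a set of normalized sequences of naturals of length `≤ a` -/
  Tr : Set (Ordinal.{0} × (Ordinal.{0} → ℕ))
  hTcount : Tr.Countable
  hTsub : ∀ s ∈ Tr, s.1 ≤ a ∧ ∀ i, s.1 ≤ i → s.2 i = 0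
  hTdc : ∀ s ∈ Tr, ∀ γ ≤ s.1, (γ, fun i => if i < γ then s.2 i else 0) ∈ Tr
  /-- the countable nonempty index set `u ⊆ ℵ_ω` -/
  u : Set Ordinal.{0}
  hu : u ⊆ Set.Iio (Cardinal.aleph Ordinal.omega0).ord
  hucount : u.Countable
  hune : u.Nonempty
  /-- the branches `η_i`, `i ∈ u` -/
  η : Ordinal.{0} → Ordinal.{0} → ℕ
  hη : ∀ i ∈ u, ∀ γ ≤ a, (γ, fun k => if k < γ then η i k else 0) ∈ Tr
  hη0 : ∀ i ∈ u, ∀ j, a ≤ j → η i j = 0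
  hηjunk : ∀ i ∉ u, η i = fun _ => 0

/-- The order on `Q`: `p ≤ q` iff `p = q`, or `α^p < α^q`, `T^q ∩ ω^{≤α^p} = T^p`,
`u^p ⊆ u^q`, and for every `i ∈ u^p` the branch `η^p_i` is the restriction of
`η^q_i` to `α^p`. -/
def QLe (p q : QCond) : Prop :=
  p = q ∨
    (p.a < q.a ∧ q.Tr ∩ {s | s.1 ≤ p.a} = p.Tr ∧ p.u ⊆ q.u ∧
      ∀ i ∈ p.u, ∀ j < p.a, p.η i j = q.η i j)

theorem QLe.lt_of_ne {p q : QCond} (h : QLe p q) (hne : p ≠ q) :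
    p.a < q.a ∧ q.Tr ∩ {s | s.1 ≤ p.a} = p.Tr ∧ p.u ⊆ q.u ∧
      ∀ i ∈ p.u, ∀ j < p.a, p.η i j = q.η i j :=
  h.resolve_left hne

open Classical in
/-- The union of the branches of a sequence of conditions, normalized to `0` where undefined. -/
noncomputable def limitBranch (p : ℕ → QCond) (i j : Ordinal.{0}) : ℕ :=
  if h : ∃ n, i ∈ (p n).u ∧ j < (p n).a then (p h.choose).η i j else 0

theorem limitBranch_eq_zero {p : ℕ → QCond} {i j : Ordinal.{0}}
    (h : ∀ n, i ∈ (p n).u → (p n).a ≤ j) : limitBranch p i j = 0 :=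
  dif_neg fun ⟨n, hi, hj⟩ => (h n hi).not_gt hj

theorem limitBranch_eq {p : ℕ → QCond}
    (hp : ∀ m n, m < n → ∀ i ∈ (p m).u, ∀ j < (p m).a, (p m).η i j = (p n).η i j)
    {n : ℕ} {i j : Ordinal.{0}} (hi : i ∈ (p n).u) (hj : j < (p n).a) :
    limitBranch p i j = (p n).η i j := by
  have h : ∃ n, i ∈ (p n).u ∧ j < (p n).a := ⟨n, hi, hj⟩
  rw [limitBranch, dif_pos h]
  obtain ⟨hi', hj'⟩ := h.choose_spec
  rcases lt_trichotomy h.choose n with hlt | heq | hlt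
  · exact hp _ _ hlt i hi' j hj'
  · rw [heq]
  · exact (hp _ _ hlt i hi j hj).symm

theorem stmt7 (p : ℕ → QCond)
    (hincr : ∀ m n : ℕ, m < n → QLe (p m) (p n) ∧ p m ≠ p n) :
    ∃ q : QCond, ∀ n, QLe (p n) q := by
  have hstep := fun m n hmn => (hincr m n hmn).1.lt_of_ne (hincr m n hmn).2
  have hamono : StrictMono fun n => (p n).a := fun m n hmn => (hstep m n hmn).1
  have humono : Monotone fun n => (p n).u :=
    monotone_nat_of_le_succ fun n => (hstep n (n + 1) n.lt_succ_self).2.2.1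
  have hTmono : Monotone fun n => (p n).Tr := monotone_nat_of_le_succ fun n => by
    have h := (hstep n (n + 1) n.lt_succ_self).2.1
    change (p n).Tr ⊆ (p (n + 1)).Tr
    rw [← h]
    exact Set.inter_subset_left
  have hη {n : ℕ} {i j : Ordinal.{0}} : i ∈ (p n).u → j < (p n).a →
      limitBranch p i j = (p n).η i j :=
    limitBranch_eq fun m n hmn => (hstep m n hmn).2.2.2
  set α : Ordinal.{0} := ⨆ n, (p n).a
  have hle (n : ℕ) : (p n).a ≤ α := Ordinal.le_iSup (fun n => (p n).a) n
  have hlt (n : ℕ) : (p n).a < α := (hamono n.lt_succ_self).trans_le (hle (n + 1))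
  have hzero (i j : Ordinal.{0}) (hj : α ≤ j) : limitBranch p i j = 0 :=
    limitBranch_eq_zero fun n _ => (hle n).trans hj
  let top (i : Ordinal.{0}) : Ordinal.{0} × (Ordinal.{0} → ℕ) := (α, limitBranch p i)
  have htrunc (i : Ordinal.{0}) (hi : i ∈ ⋃ n, (p n).u) (γ : Ordinal.{0}) (hγ : γ ≤ α) :
      (γ, fun k => if k < γ then limitBranch p i k else 0) ∈
        (⋃ n, (p n).Tr) ∪ top '' ⋃ n, (p n).u := by
    rcases hγ.lt_or_eq with hγ | rfl
    · obtain ⟨m, hm⟩ := Set.mem_iUnion.1 hi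
      obtain ⟨n, hn⟩ := Ordinal.lt_iSup_iff.1 hγ
      have hu' : i ∈ (p (max m n)).u := humono (le_max_left m n) hm
      have ha' : γ < (p (max m n)).a := hn.trans_le (hamono.monotone (le_max_right m n))
      refine Or.inl (Set.mem_iUnion.2 ⟨max m n, ?_⟩)
      convert (p (max m n)).hη i hu' γ ha'.le using 3 with k
      split_ifs with hk
      · exact hη hu' (hk.trans ha')
      · rfl
    · refine Or.inr ⟨i, hi, Prod.ext rfl (funext fun k => ?_)⟩
      dsimp only [top]
      split_ifs with hk
      · rfl
      · exact hzero i k (not_lt.1 hk)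
  have hucount : (⋃ n, (p n).u).Countable := Set.countable_iUnion fun n => (p n).hucount
  refine ⟨{
    a := α
    ha := ?_
    Tr := (⋃ n, (p n).Tr) ∪ top '' ⋃ n, (p n).u
    hTcount := (Set.countable_iUnion fun n => (p n).hTcount).union (hucount.image _)
    hTsub := ?_
    hTdc := ?_
    u := ⋃ n, (p n).u
    hu := Set.iUnion_subset fun n => (p n).hu
    hucount := hucount
    hune := (p 0).hune.mono (Set.subset_iUnion (fun n => (p n).u) 0)
    η := limitBranch p
    hη := htrunc
    hη0 := fun i _ => hzero i
    hηjunk := fun i hi => funext fun j =>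
      limitBranch_eq_zero fun n hn => (hi (Set.mem_iUnion.2 ⟨n, hn⟩)).elim }, fun n =>
    Or.inr ⟨hlt n, ?_, Set.subset_iUnion (fun n => (p n).u) n, fun i hi j hj => (hη hi hj).symm⟩⟩
  · rw [Cardinal.ord_aleph]
    exact Ordinal.iSup_lt_omega_one fun n => by
      simpa only [Cardinal.ord_aleph] using (p n).ha
  · rintro s (hs | ⟨i, -, rfl⟩)
    · obtain ⟨n, hn⟩ := Set.mem_iUnion.1 hs
      exact ⟨((p n).hTsub s hn).1.trans (hle n), ((p n).hTsub s hn).2⟩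
    · exact ⟨le_rfl, hzero i⟩
  · rintro s (hs | ⟨i, hi, rfl⟩) γ hγ
    · obtain ⟨n, hn⟩ := Set.mem_iUnion.1 hs
      exact Or.inl (Set.mem_iUnion.2 ⟨n, (p n).hTdc s hn γ hγ⟩)
    · exact htrunc i hi γ hγ
  · apply Set.Subset.antisymm
    · rintro s ⟨hs | ⟨i, -, rfl⟩, hsa⟩
      · obtain ⟨m, hm⟩ := Set.mem_iUnion.1 hs
        rcases le_or_gt m n with hmn | hmn
        · exact hTmono hmn hm
        · exact (hstep n m hmn).2.1 ▸ ⟨hm, hsa⟩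
      · exact absurd hsa (hlt n).not_ge
    · exact fun s hs => ⟨Or.inl (Set.mem_iUnion.2 ⟨n, hs⟩), ((p n).hTsub s hs).1⟩
end

section
/- Assume the Continuum Hypothesis, 2^{ℵ₀} = ℵ₁. Then the poset Q defined below satisfies the ℵ₂-chain condition: every antichain in Q has cardinality at most ℵ₁. -/
open Cardinal

universe u v w

/-- The arity of a node of the tree of codes: a node labelled `none` is a leaf, the others
branch over `ℕ`. -/
abbrev CodeArity (V : Type v) (o : Option (ℕ → ℕ × V)) : Type := {_n : ℕ // o.isSome}

theorem mk_wType_codeArity_le {V : Type v} (hV : #V ≤ 𝔠) : #(WType (CodeArity V)) ≤ 𝔠 := by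
  refine WType.cardinalMk_le_of_le' ?_
  have hshape : #(Option (ℕ → ℕ × V)) ≤ 𝔠 := by
    rw [mk_option]
    refine add_le_of_le aleph0_le_continuum ?_ (one_lt_aleph0.le.trans aleph0_le_continuum)
    have hpair : #(ℕ × V) ≤ 𝔠 := by
      rw [mk_prod]
      refine mul_le_of_le aleph0_le_continuum ?_ ?_
      · simpa using aleph0_le_continuum
      · simpa using hV
    calc #(ℕ → ℕ × V) = #(ℕ × V) ^ (ℵ₀ : Cardinal.{v}) := by simp
      _ ≤ 𝔠 ^ (ℵ₀ : Cardinal.{v}) := power_le_power_right hpair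
      _ = 𝔠 := continuum_power_aleph0
  refine (sum_le_mk_mul_iSup _).trans (mul_le_of_le aleph0_le_continuum ?_ ?_)
  · simpa using hshape
  · refine ciSup_le' fun o => ?_
    refine (power_le_power_left continuum_ne_zero ?_).trans continuum_power_aleph0.le
    simp

/-- A family of countable partial functions into a set of size at most the continuum, no two of
which are compatible, has size at most the continuum. -/
theorem mk_le_continuum_of_incompatible {ι : Type u} {I : Type w} {V : Type v} [Nonempty I]
    (hV : #V ≤ 𝔠) (dom : ι → Set I) (val : ι → I → V) (hdom : ∀ x, (dom x).Countable)
    (h : ∀ x y, (∀ i ∈ dom x, i ∈ dom y → val x i = val y i) → x = y) : #ι ≤ 𝔠 := by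
  classical
  rcases isEmpty_or_nonempty ι with hι | hι
  · simp
  choose enum henum using fun x => Set.countable_iff_exists_subset_range.1 (hdom x)
  let extends_ (o : Option (ℕ → ℕ × V)) (c : CodeArity V o → ι) (x : ι) : Prop :=
    ∀ n : CodeArity V o, val x (enum (c n) (o.get n.2 n.1).1) = (o.get n.2 n.1).2
  let decode : WType (CodeArity V) → ι :=
    WType.elim ι fun z => Classical.epsilon (extends_ z.1 z.2)
  have hdecode : ∀ o c x, extends_ o (fun n => decode (c n)) x →
      extends_ o (fun n => decode (c n)) (decode (WType.mk o c)) :=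
    fun o c x hx => Classical.epsilon_spec (p := extends_ o fun n => decode (c n)) ⟨x, hx⟩
  have hmem : ∀ t, ∀ i ∈ dom (decode t), ∃ t' k, enum (decode t') k = i := fun t i hi =>
    let ⟨k, hk⟩ := henum _ hi
    ⟨t, k, hk⟩
  have hsurj : Function.Surjective decode := by
    intro x
    let D : Set I := {i | i ∈ dom x ∧ ∃ t k, enum (decode t) k = i}
    have hD : D.Countable := (hdom x).mono fun i hi => hi.1
    rcases D.eq_empty_or_nonempty with hD0 | hD0
    · refine ⟨WType.mk none fun n => absurd n.2 (by simp), h _ _ fun i hi hix => ?_⟩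
      have : i ∈ D := ⟨hix, hmem _ i hi⟩
      simp [hD0] at this
    · obtain ⟨d, hd⟩ := hD.exists_eq_range hD0
      have hdD : ∀ n, d n ∈ D := fun n => hd ▸ Set.mem_range_self n
      choose t k htk using fun n => (hdD n).2
      refine ⟨WType.mk (some fun n => (k n, val x (d n))) fun n => t n.1,
        h _ _ fun i hi hix => ?_⟩
      have hiD : i ∈ D := ⟨hix, hmem _ i hi⟩
      obtain ⟨n, rfl⟩ := hd ▸ hiD
      have := hdecode (some fun n => (k n, val x (d n))) (fun n => t n.1) x
        (fun n => by simp [htk]) ⟨n, rfl⟩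
      simpa [htk] using this
  have hle := lift_mk_le_lift_mk_of_surjective hsurj
  rw [← lift_le_continuum.{u, v}]
  exact hle.trans (lift_le_continuum.2 (mk_wType_codeArity_le hV))

theorem mk_le_of_mk_fiber_le {α β : Type u} {κ : Cardinal.{u}} (hκ : ℵ₀ ≤ κ) (f : α → β)
    (hβ : #β ≤ κ) (hf : ∀ b, #{x // f x = b} ≤ κ) : #α ≤ κ := by
  rw [← mk_congr (Equiv.sigmaFiberEquiv f), mk_sigma]
  exact (sum_le_mk_mul_iSup _).trans (mul_le_of_le hκ hβ (ciSup_le' hf))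

theorem countable_Iio_of_lt_ord_aleph_one {a : Ordinal.{u}} (ha : a < (ℵ_ 1).ord) :
    (Set.Iio a).Countable := by
  rw [← le_aleph0_iff_set_countable, mk_Iio_ordinal, lift_le_aleph0]
  rwa [lt_ord, ← succ_aleph0, Order.lt_succ_iff] at ha

theorem mk_Iio_ord_aleph_one_le : #(Set.Iio (ℵ_ 1 : Cardinal.{u}).ord) ≤ 𝔠 := by
  rw [mk_Iio_ordinal, card_ord, lift_le_continuum]
  exact aleph_one_le_continuum

/-- The normalized sequences of naturals of length at most `a`. -/
def normalizedSeqs (a : Ordinal.{u}) : Set (Ordinal.{u} × (Ordinal.{u} → ℕ)) :=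
  {s | s.1 ≤ a ∧ ∀ i, s.1 ≤ i → s.2 i = 0}

theorem mk_normalizedSeqs_le {a : Ordinal.{u}} (ha : a < (ℵ_ 1).ord) :
    #(normalizedSeqs a) ≤ 𝔠 := by
  have hIio := countable_Iio_of_lt_ord_aleph_one ha
  have hIic : (Set.Iic a).Countable := by
    rw [← Set.Iio_union_right]
    exact hIio.union (Set.countable_singleton a)
  let f : normalizedSeqs a → Set.Iic a × (Set.Iio a → ℕ) :=
    fun s => (⟨s.1.1, s.2.1⟩, fun i => s.1.2 i)
  have hf : Function.Injective f := by
    rintro ⟨⟨b, g⟩, hba, hg⟩ ⟨⟨b', g'⟩, hba', hg'⟩ hs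
    obtain ⟨hb, hs⟩ := Prod.mk.inj hs
    obtain rfl : b = b' := congrArg Subtype.val hb
    have : g = g' := by
      funext i
      rcases lt_or_ge i a with hi | hi
      · exact congrFun hs ⟨i, hi⟩
      · exact (hg i (hba.trans hi)).trans (hg' i (hba.trans hi)).symm
    subst this
    rfl
  refine (mk_le_of_injective hf).trans ?_
  rw [mk_prod, lift_id, lift_id]
  refine mul_le_of_le aleph0_le_continuum
    ((le_aleph0_iff_set_countable.2 hIic).trans aleph0_le_continuum) ?_
  calc #(Set.Iio a → ℕ) = ℵ₀ ^ #(Set.Iio a) := by simp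
    _ ≤ ℵ₀ ^ ℵ₀ := power_le_power_left aleph0_ne_zero (le_aleph0_iff_set_countable.2 hIio)
    _ = 𝔠 := aleph0_power_aleph0

theorem mk_countable_nonempty_subsets_le {α : Type u} {X : Set α} (hX : #X ≤ 𝔠) :
    #{T : Set α // T ⊆ X ∧ T.Countable ∧ T.Nonempty} ≤ 𝔠 := by
  have hex : ∀ T : {T : Set α // T ⊆ X ∧ T.Countable ∧ T.Nonempty},
      ∃ f : ℕ → X, T.1 = Set.range fun n => (f n : α) := by
    rintro ⟨T, hTX, hT, hT0⟩
    obtain ⟨f, rfl⟩ := hT.exists_eq_range hT0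
    exact ⟨fun n => ⟨f n, hTX ⟨n, rfl⟩⟩, rfl⟩
  choose f hf using hex
  have hinj : Function.Injective f := fun S T hST =>
    Subtype.ext (by rw [hf S, hf T, hST])
  calc _ ≤ #(ℕ → X) := mk_le_of_injective hinj
    _ = #X ^ (ℵ₀ : Cardinal.{u}) := by simp
    _ ≤ 𝔠 ^ (ℵ₀ : Cardinal.{u}) := power_le_power_right hX
    _ = 𝔠 := continuum_power_aleph0

namespace QCond

theorem branch_mem (p : QCond) {i : Ordinal} (hi : i ∈ p.u) : (p.a, p.η i) ∈ p.Tr := by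
  convert p.hη i hi p.a le_rfl using 2
  funext k
  split_ifs with hk
  · rfl
  · exact p.hη0 i hi k (not_lt.1 hk)

theorem tr_nonempty (p : QCond) : p.Tr.Nonempty :=
  let ⟨_, hi⟩ := p.hune
  ⟨_, p.branch_mem hi⟩

/-- Two conditions with the same height and tree whose branches agree on the common indices have
a common upper bound. -/
theorem exists_upper_bound {p q : QCond} (ha : p.a = q.a) (hTr : p.Tr = q.Tr)
    (hη : ∀ i ∈ p.u, i ∈ q.u → p.η i = q.η i) : ∃ r : QCond, QLe p r ∧ QLe q r := by
  classical
  let e : Ordinal → Ordinal → ℕ := fun i => if i ∈ p.u then p.η i else q.η i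
  have hep : ∀ i ∈ p.u, e i = p.η i := fun i hi => if_pos hi
  have heq : ∀ i ∈ q.u, e i = q.η i := by
    intro i hi
    by_cases hip : i ∈ p.u
    · rw [hep i hip, hη i hip hi]
    · exact if_neg hip
  have hmem : ∀ i ∈ p.u ∪ q.u, ∀ γ ≤ p.a, (γ, fun k => if k < γ then e i k else 0) ∈ p.Tr := by
    rintro i (hi | hi) γ hγ
    · rw [hep i hi]
      exact p.hη i hi γ hγ
    · rw [heq i hi, hTr]
      exact q.hη i hi γ (ha ▸ hγ)
  have hzero : ∀ i ∈ p.u ∪ q.u, ∀ j, p.a ≤ j → e i j = 0 := by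
    rintro i (hi | hi) j hj
    · rw [hep i hi]
      exact p.hη0 i hi j hj
    · rw [heq i hi]
      exact q.hη0 i hi j (ha ▸ hj)
  let S : Set (Ordinal × (Ordinal → ℕ)) := (fun i => (Order.succ p.a, e i)) '' (p.u ∪ q.u)
  have hbranch : ∀ i ∈ p.u ∪ q.u, ∀ γ ≤ Order.succ p.a,
      (γ, fun k => if k < γ then e i k else 0) ∈ p.Tr ∪ S := by
    intro i hi γ hγ
    rcases hγ.lt_or_eq with hlt | rfl
    · exact Or.inl (hmem i hi γ (Order.lt_succ_iff.1 hlt))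
    · refine Or.inr ⟨i, hi, ?_⟩
      refine congrArg (Prod.mk _) (funext fun k => ?_)
      split_ifs with hk
      · rfl
      · exact hzero i hi k ((Order.le_succ _).trans (not_lt.1 hk))
  have hrestrict : (p.Tr ∪ S) ∩ {s | s.1 ≤ p.a} = p.Tr := by
    ext s
    constructor
    · rintro ⟨hs | ⟨i, -, rfl⟩, hsa⟩
      · exact hs
      · exact absurd hsa (not_le.2 (Order.lt_succ p.a))
    · exact fun hs => ⟨Or.inl hs, (p.hTsub s hs).1⟩
  refine ⟨{ a := Order.succ p.a
            ha := (isSuccLimit_ord (aleph0_le_aleph 1)).succ_lt p.ha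
            Tr := p.Tr ∪ S
            hTcount := p.hTcount.union ((p.hucount.union q.hucount).image _)
            hTsub := ?_
            hTdc := ?_
            u := p.u ∪ q.u
            hu := Set.union_subset p.hu q.hu
            hucount := p.hucount.union q.hucount
            hune := p.hune.inl
            η := e
            hη := hbranch
            hη0 := fun i hi j hj => hzero i hi j ((Order.le_succ _).trans hj)
            hηjunk := ?_ }, Or.inr ⟨Order.lt_succ p.a, hrestrict, Set.subset_union_left, ?_⟩,
          Or.inr ⟨ha.symm.trans_lt (Order.lt_succ p.a), ?_, Set.subset_union_right, ?_⟩⟩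
  · rintro s (hs | ⟨i, hi, rfl⟩)
    · exact ⟨(p.hTsub s hs).1.trans (Order.le_succ _), (p.hTsub s hs).2⟩
    · exact ⟨le_rfl, fun j hj => hzero i hi j ((Order.le_succ _).trans hj)⟩
  · rintro s (hs | ⟨i, hi, rfl⟩) γ hγ
    · exact Or.inl (p.hTdc s hs γ hγ)
    · exact hbranch i hi γ hγ
  · intro i hi
    exact (if_neg fun h => hi (Or.inl h)).trans (q.hηjunk i fun h => hi (Or.inr h))
  · intro i hi j _
    exact congrFun (hep i hi).symm j
  · rw [← ha, ← hTr]
    exact hrestrict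
  · intro i hi j _
    exact congrFun (heq i hi).symm j

theorem mk_antichain_le_of_fixed_tree {ι : Type u} (c : ι → QCond)
    (hc : ∀ x y, (∃ r : QCond, QLe (c x) r ∧ QLe (c y) r) → x = y) {a : Ordinal.{0}}
    {T : Set (Ordinal.{0} × (Ordinal.{0} → ℕ))} (ha : ∀ x, (c x).a = a)
    (hT : ∀ x, (c x).Tr = T) : #ι ≤ 𝔠 := by
  rcases isEmpty_or_nonempty ι with hι | ⟨⟨x₀⟩⟩
  · simp
  have hTc : T.Countable := hT x₀ ▸ (c x₀).hTcount
  obtain ⟨f, hf⟩ := Set.countable_iff_exists_injOn.1 hTc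
  have hmem : ∀ x, ∀ i ∈ (c x).u, (a, (c x).η i) ∈ T := fun x i hi =>
    hT x ▸ ha x ▸ (c x).branch_mem hi
  refine mk_le_continuum_of_incompatible (V := ℕ) (by simpa using aleph0_le_continuum)
    (fun x => (c x).u) (fun x i => f (a, (c x).η i)) (fun x => (c x).hucount) fun x y hxy =>
    hc x y (exists_upper_bound ((ha x).trans (ha y).symm) ((hT x).trans (hT y).symm) ?_)
  exact fun i hi hi' => congrArg Prod.snd (hf (hmem x i hi) (hmem y i hi') (hxy i hi hi'))

theorem mk_antichain_le_continuum (A : Set QCond)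
    (hA : ∀ p ∈ A, ∀ q ∈ A, p ≠ q → ¬∃ r : QCond, QLe p r ∧ QLe q r) : #A ≤ 𝔠 := by
  refine mk_le_of_mk_fiber_le aleph0_le_continuum
    (fun p : A => (⟨p.1.a, p.1.ha⟩ : Set.Iio (ℵ_ 1).ord)) mk_Iio_ord_aleph_one_le ?_
  rintro ⟨a, ha⟩
  have hpa : ∀ p : {p : A // (⟨p.1.a, p.1.ha⟩ : Set.Iio (ℵ_ 1).ord) = ⟨a, ha⟩},
      p.1.1.a = a := fun p => congrArg Subtype.val p.2
  refine mk_le_of_mk_fiber_le aleph0_le_continuum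
    (fun p => (⟨p.1.1.Tr, fun s hs => hpa p ▸ p.1.1.hTsub s hs, p.1.1.hTcount,
      p.1.1.tr_nonempty⟩ : {T // T ⊆ normalizedSeqs a ∧ T.Countable ∧ T.Nonempty}))
    (mk_countable_nonempty_subsets_le (mk_normalizedSeqs_le ha)) ?_
  rintro ⟨T, hT⟩
  refine mk_antichain_le_of_fixed_tree (fun p => p.1.1.1) ?_ (fun p => hpa p.1)
    (fun p => congrArg Subtype.val p.2)
  intro x y hxy
  by_contra hne
  exact hA _ x.1.1.2 _ y.1.1.2
    (fun h => hne (Subtype.ext (Subtype.ext (Subtype.ext h)))) hxy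

end QCond

theorem stmt8 (hCH : (2 : Cardinal.{1}) ^ (Cardinal.aleph0 : Cardinal.{1}) = Cardinal.aleph 1)
    (A : Set QCond)
    (hA : ∀ p ∈ A, ∀ q ∈ A, p ≠ q → ¬∃ r : QCond, QLe p r ∧ QLe q r) :
    Cardinal.mk A ≤ Cardinal.aleph 1 := by
  rw [← hCH, two_power_aleph0]
  exact QCond.mk_antichain_le_continuum A hA
end
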